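/- arXiv:1406.6657 — 13 statements merged into one kernel-verified Lean document; each statement's English description precedes it below -/
import Mathlib

section
/- Let X be a real normed vector space and X₊ ⊆ X a closed cone, with the partial order x ≤ y iff y − x ∈ X₊, and let ψ(x) = d(x, −X₊). Then X₊ is normal (i.e., there exists M ≥ 0 such that ‖x‖ ≤ M‖y‖ whenever x, y ∈ X₊ and x ≤ y) if and only if there exists δ > 0 such that δ‖x‖ ≤ ψ(x) for all x ∈ X₊. -/
open Metric Filter Topology

/-- The cone `X₊` is normal iff the monotone companion half-norm `ψ(x) = d(x, -X₊)`
dominates a positive multiple of the norm on the cone. -/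
theorem normal_iff_half_norm_bound
    {X : Type*} [NormedAddCommGroup X] [NormedSpace ℝ X]
    (K : Set X) (hK : IsClosed K) (hconv : Convex ℝ K)
    (hsmul : ∀ α : ℝ, 0 ≤ α → ∀ x ∈ K, α • x ∈ K)
    (hpointed : K ∩ (-K) = {0}) :
    (∃ M : ℝ, 0 ≤ M ∧ ∀ x ∈ K, ∀ y ∈ K, y - x ∈ K → ‖x‖ ≤ M * ‖y‖) ↔
    (∃ δ : ℝ, 0 < δ ∧ ∀ x ∈ K, δ * ‖x‖ ≤ Metric.infDist x (-K)) := by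
  have h0 : (0 : X) ∈ K := by
    have h : (0 : X) ∈ K ∩ (-K) := by rw [hpointed]; rfl
    exact h.1
  have hadd : ∀ x ∈ K, ∀ y ∈ K, x + y ∈ K := by
    intro x hx y hy
    have h := hsmul 2 (by norm_num) _
      (hconv hx hy (by norm_num : (0 : ℝ) ≤ 1 / 2) (by norm_num : (0 : ℝ) ≤ 1 / 2) (by norm_num))
    rw [smul_add, smul_smul, smul_smul] at h
    norm_num at h
    exact h
  constructor
  · rintro ⟨M, hM, h⟩
    refine ⟨1 / (M + 1), by positivity, fun x hx => ?_⟩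
    rw [Metric.le_infDist ⟨0, by simpa using h0⟩]
    intro z hz
    have hz' : -z ∈ K := hz
    have h1 := h x hx (x - z) (by rw [sub_eq_add_neg]; exact hadd x hx _ hz')
      (by rw [sub_sub_cancel_left]; exact hz')
    rw [dist_eq_norm, div_mul_eq_mul_div, one_mul, div_le_iff₀ (by positivity)]
    nlinarith [norm_nonneg (x - z)]
  · rintro ⟨δ, hδ, h⟩
    refine ⟨1 / δ, by positivity, fun x hx y hy hxy => ?_⟩
    have h1 := h x hx
    have h2 : Metric.infDist x (-K) ≤ dist x (x - y) :=
      Metric.infDist_le_dist_of_mem (by simpa using hxy)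
    rw [dist_eq_norm, sub_sub_cancel] at h2
    rw [div_mul_eq_mul_div, one_mul, le_div_iff₀ hδ]
    linarith
end

section
/- Let X be a real normed vector space and X₊ ⊆ X a closed cone, with the partial order x ≤ y iff y − x ∈ X₊. Let ψ(x) = d(x, −X₊) and define ♯x♯ = max{ψ(x), ψ(−x)}. Then ♯·♯ is a norm on X satisfying: (i) ♯x♯ ≤ ‖x‖ for all x ∈ X; (ii) ♯x♯ = ψ(x) for x ∈ X₊ and ♯x♯ = ψ(−x) for −x ∈ X₊; (iii) ♯·♯ is order-preserving on X₊, i.e., ♯x♯ ≤ ♯y♯ for all x, y ∈ X₊ with x ≤ y; and (iv) for all x, y, z ∈ X with x ≤ y ≤ z, ♯y♯ ≤ max{♯x♯, ♯z♯}. -/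
open Metric Filter Topology

/-- The monotone companion norm `♯x♯ = max{ψ(x), ψ(-x)}`, with `ψ(x) = d(x, -X₊)`,
is a norm, is dominated by the original norm, coincides with `ψ` on `±X₊`,
is order-preserving on `X₊`, and satisfies `♯y♯ ≤ max{♯x♯, ♯z♯}` for `x ≤ y ≤ z`. -/
theorem companion_norm_properties
    {X : Type*} [NormedAddCommGroup X] [NormedSpace ℝ X]
    (K : Set X) (hK : IsClosed K) (hconv : Convex ℝ K)
    (hsmul : ∀ α : ℝ, 0 ≤ α → ∀ x ∈ K, α • x ∈ K)
    (hpointed : K ∩ (-K) = {0})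
    (sharp : X → ℝ)
    (hsharp : ∀ x : X,
      sharp x = max (Metric.infDist x (-K)) (Metric.infDist (-x) (-K))) :
    -- ♯·♯ is a norm:
    (∀ x : X, 0 ≤ sharp x) ∧
    (∀ x : X, sharp x = 0 ↔ x = 0) ∧
    (∀ (α : ℝ) (x : X), sharp (α • x) = |α| * sharp x) ∧
    (∀ x y : X, sharp (x + y) ≤ sharp x + sharp y) ∧
    -- (i) dominated by the original norm:
    (∀ x : X, sharp x ≤ ‖x‖) ∧
    -- (ii) coincides with ψ on the cone and on its negative:
    (∀ x ∈ K, sharp x = Metric.infDist x (-K)) ∧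
    (∀ x : X, -x ∈ K → sharp x = Metric.infDist (-x) (-K)) ∧
    -- (iii) order-preserving on the cone:
    (∀ x ∈ K, ∀ y ∈ K, y - x ∈ K → sharp x ≤ sharp y) ∧
    -- (iv) betweenness estimate:
    (∀ x y z : X, y - x ∈ K → z - y ∈ K → sharp y ≤ max (sharp x) (sharp z)) := by
  have hn : ∀ x : X, x ∈ -K ↔ -x ∈ K := fun x => Iff.rfl
  have hcl : IsClosed (-K) := hK.preimage continuous_neg
  have h0 : (0 : X) ∈ K := by
    have h : (0 : X) ∈ K ∩ (-K) := by rw [hpointed]; rfl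
    exact h.1
  have h0n : (0 : X) ∈ -K := by rw [hn, neg_zero]; exact h0
  have hne : (-K).Nonempty := ⟨0, h0n⟩
  have hadd : ∀ x ∈ K, ∀ y ∈ K, x + y ∈ K := by
    intro x hx y hy
    have h := hconv (hsmul 2 (by norm_num) x hx) (hsmul 2 (by norm_num) y hy)
      (by norm_num : (0:ℝ) ≤ 1/2) (by norm_num : (0:ℝ) ≤ 1/2) (by norm_num)
    simpa [smul_smul] using h
  have hnn : ∀ x : X, 0 ≤ infDist x (-K) := fun x => infDist_nonneg
  have hz : ∀ x : X, infDist x (-K) = 0 ↔ -x ∈ K := by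
    intro x
    rw [← hn, hcl.mem_iff_infDist_zero hne]
  have hsub : ∀ x y : X, infDist (x + y) (-K) ≤ infDist x (-K) + infDist y (-K) := by
    intro x y
    refine le_of_forall_pos_le_add fun ε hε => ?_
    obtain ⟨u, hu, hxu⟩ := (infDist_lt_iff hne).1 (show infDist x (-K) < infDist x (-K) + ε/2 by linarith)
    obtain ⟨v, hv, hyv⟩ := (infDist_lt_iff hne).1 (show infDist y (-K) < infDist y (-K) + ε/2 by linarith)
    have huv : u + v ∈ -K := by
      rw [hn] at *
      rw [neg_add]; exact hadd _ hu _ hv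
    have h1 := infDist_le_dist_of_mem (x := x + y) huv
    have h2 := dist_add_add_le x y u v
    linarith
  have hhom' : ∀ a : ℝ, 0 ≤ a → ∀ x : X, infDist (a • x) (-K) ≤ a * infDist x (-K) := by
    intro a ha x
    rcases ha.eq_or_lt with rfl | ha
    · simp [infDist_zero_of_mem h0n]
    rw [← div_le_iff₀' ha]
    refine (le_infDist hne).2 fun u hu => ?_
    rw [div_le_iff₀' ha]
    have hau : a • u ∈ -K := by
      rw [hn] at *
      rw [← smul_neg]; exact hsmul a ha.le _ hu
    have h1 := infDist_le_dist_of_mem (x := a • x) hau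
    rwa [dist_smul₀, Real.norm_of_nonneg ha.le] at h1
  have hhom : ∀ a : ℝ, 0 ≤ a → ∀ x : X, infDist (a • x) (-K) = a * infDist x (-K) := by
    intro a ha x
    rcases ha.eq_or_lt with rfl | ha
    · simp [infDist_zero_of_mem h0n]
    refine le_antisymm (hhom' a ha.le x) ?_
    have h := hhom' a⁻¹ (inv_nonneg.2 ha.le) (a • x)
    rw [inv_smul_smul₀ ha.ne'] at h
    rwa [le_inv_mul_iff₀ ha] at h
  have hmono : ∀ x y : X, y - x ∈ K → infDist x (-K) ≤ infDist y (-K) := by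
    intro x y h
    have h1 := hsub y (x - y)
    rw [(hz (x - y)).2 (by rwa [neg_sub])] at h1
    simpa using h1
  have hnorm : ∀ x : X, infDist x (-K) ≤ ‖x‖ := by
    intro x
    simpa using infDist_le_dist_of_mem (x := x) h0n
  have hii : ∀ x ∈ K, sharp x = infDist x (-K) := by
    intro x hx
    rw [hsharp, (hz (-x)).2 (by rwa [neg_neg]), max_eq_left (hnn x)]
  refine ⟨?_, ?_, ?_, ?_, ?_, hii, ?_, ?_, ?_⟩
  · intro x; rw [hsharp]; exact le_max_of_le_left (hnn x)
  · intro x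
    constructor
    · intro h
      rw [hsharp] at h
      have h1 : infDist x (-K) = 0 := le_antisymm (h ▸ le_max_left _ _) (hnn x)
      have h2 : infDist (-x) (-K) = 0 := le_antisymm (h ▸ le_max_right _ _) (hnn _)
      rw [hz] at h1 h2
      rw [neg_neg] at h2
      have : x ∈ K ∩ (-K) := ⟨h2, h1⟩
      rw [hpointed] at this
      exact this
    · rintro rfl
      rw [hii 0 h0, infDist_zero_of_mem h0n]
  · intro a x
    rw [hsharp, hsharp]
    rcases le_total 0 a with ha | ha
    · rw [← smul_neg, hhom a ha, hhom a ha, abs_of_nonneg ha, mul_max_of_nonneg _ _ ha]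
    · have hb : 0 ≤ -a := neg_nonneg.2 ha
      rw [← neg_smul, hhom (-a) hb, show a • x = (-a) • (-x) by simp, hhom (-a) hb,
        abs_of_nonpos ha, mul_max_of_nonneg _ _ hb, max_comm]
  · intro x y
    rw [hsharp, hsharp x, hsharp y]
    refine max_le ((hsub x y).trans (add_le_add (le_max_left _ _) (le_max_left _ _))) ?_
    rw [neg_add]
    exact (hsub _ _).trans (add_le_add (le_max_right _ _) (le_max_right _ _))
  · intro x
    rw [hsharp]
    exact max_le (hnorm x) ((hnorm (-x)).trans (norm_neg x).le)
  · intro x hx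
    rw [hsharp, (hz x).2 hx, max_eq_right (hnn _)]
  · intro x hx y hy h
    rw [hii x hx, hii y hy]
    exact hmono x y h
  · intro x y z hxy hyz
    rw [hsharp, hsharp x, hsharp z]
    refine max_le ((hmono y z hyz).trans ?_) ((hmono (-y) (-x) ?_).trans ?_)
    · exact (le_max_left _ _).trans (le_max_right _ _)
    · rwa [show -x - -y = y - x by abel]
    · exact (le_max_right _ _).trans (le_max_left _ _)
end

section
/- Let X be a real normed vector space and X₊ ⊆ X a closed cone, with the partial order x ≤ y iff y − x ∈ X₊, and let ♯x♯ = max{d(x, −X₊), d(−x, −X₊)} be the monotone companion norm. Then X₊ is normal (i.e., there exists M ≥ 0 such that ‖x‖ ≤ M‖y‖ whenever x, y ∈ X₊ and x ≤ y) if and only if the norm ♯·♯ is equivalent to the original norm ‖·‖, i.e., there exists δ > 0 such that δ‖x‖ ≤ ♯x♯ ≤ ‖x‖ for all x ∈ X. -/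
open Metric Filter Topology

/-- The cone `X₊` is normal iff the monotone companion norm
`♯x♯ = max{d(x, -X₊), d(-x, -X₊)}` is equivalent to the original norm. -/
theorem normal_iff_companion_norm_equivalent
    {X : Type*} [NormedAddCommGroup X] [NormedSpace ℝ X]
    (K : Set X) (hK : IsClosed K) (hconv : Convex ℝ K)
    (hsmul : ∀ α : ℝ, 0 ≤ α → ∀ x ∈ K, α • x ∈ K)
    (hpointed : K ∩ (-K) = {0})
    (sharp : X → ℝ)
    (hsharp : ∀ x : X,
      sharp x = max (Metric.infDist x (-K)) (Metric.infDist (-x) (-K))) :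
    (∃ M : ℝ, 0 ≤ M ∧ ∀ x ∈ K, ∀ y ∈ K, y - x ∈ K → ‖x‖ ≤ M * ‖y‖) ↔
    (∃ δ : ℝ, 0 < δ ∧ ∀ x : X, δ * ‖x‖ ≤ sharp x ∧ sharp x ≤ ‖x‖) := by
  have h0 : (0 : X) ∈ K := by
    have : (0 : X) ∈ K ∩ (-K) := by rw [hpointed]; rfl
    exact this.1
  have h0' : (0 : X) ∈ -K := by simpa using h0
  have hadd : ∀ a ∈ K, ∀ b ∈ K, a + b ∈ K := by
    intro a ha b hb
    have h := hconv ha hb (a := 1/2) (b := 1/2) (by norm_num) (by norm_num) (by norm_num)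
    have h2 := hsmul 2 (by norm_num) _ h
    have e : (2 : ℝ) • ((1/2 : ℝ) • a + (1/2 : ℝ) • b) = a + b := by module
    rwa [e] at h2
  constructor
  · rintro ⟨M, hM, h⟩
    refine ⟨1 / (1 + 2 * M), by positivity, fun x => ⟨?_, ?_⟩⟩
    · rw [div_mul_eq_mul_div, one_mul, div_le_iff₀ (by positivity), ← div_le_iff₀ (by positivity)]
      refine le_of_forall_gt_imp_ge_of_dense fun s hs => ?_
      rw [hsharp, max_lt_iff] at hs
      obtain ⟨u, hu, hu'⟩ := (Metric.infDist_lt_iff ⟨0, h0'⟩).1 hs.1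
      obtain ⟨v, hv, hv'⟩ := (Metric.infDist_lt_iff ⟨0, h0'⟩).1 hs.2
      rw [dist_eq_norm] at hu' hv'
      have hk := h (-u) hu (-u + -v) (hadd _ hu _ hv) (by simpa using hv)
      have e : -u + -v = (x - u) + (-x - v) := by abel
      have e1 : ‖-u + -v‖ ≤ 2 * s := by
        rw [e]; linarith [norm_add_le (x - u) (-x - v)]
      have e2 : ‖x‖ ≤ ‖x - u‖ + ‖-u‖ := by
        have := norm_add_le (x - u) u
        rw [sub_add_cancel] at this
        rwa [norm_neg]
      have e3 := mul_le_mul_of_nonneg_left e1 hM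
      rw [div_le_iff₀ (by positivity)]
      linarith
    · rw [hsharp]
      refine max_le ?_ ?_
      · simpa using Metric.infDist_le_dist_of_mem (x := x) h0'
      · simpa using Metric.infDist_le_dist_of_mem (x := -x) h0'
  · rintro ⟨δ, hδ, h⟩
    refine ⟨1 / δ, by positivity, fun x hx y hy hxy => ?_⟩
    rw [div_mul_eq_mul_div, one_mul, le_div_iff₀ hδ, mul_comm]
    refine (h x).1.trans ?_
    rw [hsharp]
    refine max_le ?_ ?_
    · have hm : -(y - x) ∈ -K := by simpa using hxy
      have := Metric.infDist_le_dist_of_mem (x := x) hm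
      rw [dist_eq_norm] at this
      simpa using this
    · rw [Metric.infDist_zero_of_mem (by simpa using hx)]
      exact norm_nonneg _
end

section
/- Let X be a real normed vector space and X₊ ⊆ X a closed cone, with the partial order x ≤ y iff y − x ∈ X₊. Assume that X₊ is a complete metric subspace of X and that every element of X₊ is a normal point, i.e., for each u ∈ X₊ the set {‖x‖ : x ∈ X₊, x ≤ u} is a bounded subset of ℝ. Then X₊ is a normal cone, i.e., there exists M ≥ 0 such that ‖x‖ ≤ M‖y‖ whenever x, y ∈ X₊ and x ≤ y. -/
open Metric Filter Topology

/-- If the closed cone `X₊` is complete and every element of `X₊` is a normal point,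
then `X₊` is a normal cone. -/
theorem normal_of_complete_of_all_normal_points
    {X : Type*} [NormedAddCommGroup X] [NormedSpace ℝ X]
    (K : Set X) (hK : IsClosed K) (hconv : Convex ℝ K)
    (hsmul : ∀ α : ℝ, 0 ≤ α → ∀ x ∈ K, α • x ∈ K)
    (hpointed : K ∩ (-K) = {0})
    (hcomplete : IsComplete K)
    (hpts : ∀ u ∈ K, BddAbove {r : ℝ | ∃ x ∈ K, u - x ∈ K ∧ r = ‖x‖}) :
    ∃ M : ℝ, 0 ≤ M ∧ ∀ x ∈ K, ∀ y ∈ K, y - x ∈ K → ‖x‖ ≤ M * ‖y‖ := by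
  have hadd : ∀ x ∈ K, ∀ y ∈ K, x + y ∈ K := by
    intro x hx y hy
    have h := hconv (hsmul 2 (by norm_num) x hx) (hsmul 2 (by norm_num) y hy)
      (show (0:ℝ) ≤ 1/2 by norm_num) (show (0:ℝ) ≤ 1/2 by norm_num) (by norm_num)
    simpa [smul_smul] using h
  have h0 : (0:X) ∈ K := by
    have : (0:X) ∈ K ∩ (-K) := by rw [hpointed]; simp
    exact this.1
  by_contra! hcon
  have hex : ∀ n : ℕ, ∃ p : X × X, p.1 ∈ K ∧ p.2 - p.1 ∈ K ∧ p.2 ∈ K ∧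
      ‖p.2‖ = (1/2:ℝ)^n ∧ (2:ℝ)^n ≤ ‖p.1‖ := by
    intro n
    obtain ⟨x, hx, y, hy, hxy, hlt⟩ := hcon ((4:ℝ)^n) (by positivity)
    have hy0 : y ≠ 0 := by
      rintro rfl
      have : x ∈ K ∩ (-K) := ⟨hx, by simpa using hxy⟩
      rw [hpointed] at this
      simp only [Set.mem_singleton_iff] at this
      simp [this] at hlt
    have hyp : 0 < ‖y‖ := norm_pos_iff.mpr hy0
    have hc : 0 ≤ (1/2:ℝ)^n / ‖y‖ := by positivity
    refine ⟨(((1/2:ℝ)^n / ‖y‖) • x, ((1/2:ℝ)^n / ‖y‖) • y), hsmul _ hc _ hx, ?_,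
      hsmul _ hc _ hy, ?_, ?_⟩
    · simpa [smul_sub] using hsmul _ hc _ hxy
    · simp only [norm_smul, Real.norm_of_nonneg hc]
      field_simp
    · simp only [norm_smul, Real.norm_of_nonneg hc]
      have h4 : (2:ℝ)^n = (1/2:ℝ)^n / ‖y‖ * (4^n * ‖y‖) := by
        have : (2:ℝ)^n = (1/2:ℝ)^n * 4^n := by rw [← mul_pow]; norm_num
        rw [this]; field_simp
      rw [h4]
      exact mul_le_mul_of_nonneg_left hlt.le hc
  choose p hp1 hp12 hp2 hpn hpb using hex
  have hsum : ∀ s : Finset ℕ, ∑ i ∈ s, (p i).2 ∈ K := by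
    intro s
    exact Finset.sum_induction _ (· ∈ K) (fun a b ha hb => hadd a ha b hb) h0
      (fun i _ => hp2 i)
  have hcau : CauchySeq (fun n => ∑ i ∈ Finset.range n, (p i).2) := by
    apply cauchySeq_of_le_geometric (1/2) 1 (by norm_num)
    intro n
    rw [Finset.sum_range_succ, dist_eq_norm]
    simp [hpn]
  obtain ⟨u, hu, hlim⟩ := cauchySeq_tendsto_of_isComplete hcomplete (fun n => hsum _) hcau
  have hle : ∀ n, u - (p n).2 ∈ K := by
    intro n
    refine hK.mem_of_tendsto (hlim.sub_const (p n).2) ?_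
    filter_upwards [eventually_gt_atTop n] with m hm
    rw [← Finset.sum_erase_eq_sub (Finset.mem_range.mpr hm)]
    exact hsum _
  obtain ⟨B, hB⟩ := hpts u hu
  obtain ⟨n, hn⟩ := pow_unbounded_of_one_lt B (show (1:ℝ) < 2 by norm_num)
  have := hB ⟨(p n).1, hp1 n, by simpa using hadd _ (hle n) _ (hp12 n), rfl⟩
  linarith [hpb n]
end

section
/- Let X be a real normed vector space and X₊ ⊆ X a closed cone, with the partial order x ≤ y iff y − x ∈ X₊. Assume X₊ is a complete metric subspace of X and the norm is additive on X₊, i.e., ‖x + z‖ = ‖x‖ + ‖z‖ for all x, z ∈ X₊. Then X₊ is fully regular: every increasing sequence (xₙ) in X₊ (xₙ ≤ xₙ₊₁ for all n) that is norm-bounded converges in X. -/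
open Metric Filter Topology

/-- If the closed cone `X₊` is complete and the norm is additive on `X₊`, then `X₊` is
fully regular: every increasing norm-bounded sequence in `X₊` converges. -/
theorem fullyRegular_of_complete_of_additive_norm
    {X : Type*} [NormedAddCommGroup X] [NormedSpace ℝ X]
    (K : Set X) (hK : IsClosed K) (hconv : Convex ℝ K)
    (hsmul : ∀ α : ℝ, 0 ≤ α → ∀ x ∈ K, α • x ∈ K)
    (hpointed : K ∩ (-K) = {0})
    (hcomplete : IsComplete K)
    (hadd : ∀ x ∈ K, ∀ z ∈ K, ‖x + z‖ = ‖x‖ + ‖z‖) :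
    ∀ x : ℕ → X, (∀ n, x n ∈ K) → (∀ n, x (n + 1) - x n ∈ K) →
      (∃ C : ℝ, ∀ n, ‖x n‖ ≤ C) →
      ∃ l : X, Filter.Tendsto x Filter.atTop (nhds l) := by
  intro x hx hinc ⟨C, hC⟩
  have hd : ∀ n, dist (x n) (x (n + 1)) = ‖x (n + 1)‖ - ‖x n‖ := by
    intro n
    have h := hadd (x n) (hx n) _ (hinc n)
    rw [add_sub_cancel] at h
    rw [dist_comm, dist_eq_norm]
    linarith
  have hs : Summable (fun n => dist (x n) (x (n + 1))) := by
    refine summable_of_sum_range_le (c := C) (fun n => dist_nonneg) (fun n => ?_)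
    rw [Finset.sum_congr rfl (fun i _ => hd i), Finset.sum_range_sub (fun n => ‖x n‖)]
    have h1 := hC n
    have h2 := norm_nonneg (x 0)
    linarith
  obtain ⟨l, _, hl⟩ := cauchySeq_tendsto_of_isComplete hcomplete hx
    (cauchySeq_of_summable_dist hs)
  exact ⟨l, hl⟩
end

section
/- For a real sequence x = (xₙ)_{n≥1} of bounded variation (i.e., ‖x‖_bv := |x₁| + Σ_{n=1}^∞ |x_{n+1} − xₙ| < ∞) with xₙ ≥ 0 for all n, the following are equivalent: x is a normal point of the cone bv₊ of nonnegative sequences of bounded variation (i.e., sup{‖v‖_bv : v ∈ bv₊, vₙ ≤ xₙ for all n} < ∞) if and only if Σ_{n=1}^∞ |xₙ| < ∞. Moreover, if x is summable then ‖x‖₁ − (1/2)x₁ ≤ sup{‖v‖_bv : v ∈ bv₊, vₙ ≤ xₙ for all n} ≤ 2‖x‖₁, where ‖x‖₁ = Σ_{n=1}^∞ |xₙ|. -/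
open Metric Filter Topology

def bvS (x : ℕ → ℝ) : Set ℝ := {r : ℝ | ∃ v : ℕ → ℝ, (∀ n, 0 ≤ v n) ∧
        Summable (fun n => |v (n + 1) - v n|) ∧ (∀ n, v n ≤ x n) ∧
        r = |v 0| + ∑' n, |v (n + 1) - v n|}

lemma bvS_mem (x v : ℕ → ℝ) (hv : ∀ n, 0 ≤ v n) (hs : Summable v) (hle : ∀ n, v n ≤ x n)
    (h0 : ∀ n, v n = 0 ∨ v (n + 1) = 0) : 2 * ∑' n, v n ∈ bvS x := by
  have e : (fun n => |v (n + 1) - v n|) = fun n => v (n + 1) + v n := by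
    funext n
    rcases h0 n with h | h
    · simp [h, abs_of_nonneg (hv _)]
    · simp [h, abs_of_nonneg (hv _)]
  have hs1 : Summable (fun n => v (n + 1)) := (summable_nat_add_iff 1).2 hs
  refine ⟨v, hv, ?_, hle, ?_⟩
  · rw [e]; exact hs1.add hs
  · rw [e, hs1.tsum_add hs, abs_of_nonneg (hv 0)]
    have := hs.tsum_eq_zero_add
    linarith

lemma bvS_lower (x : ℕ → ℝ) (hx : ∀ n, 0 ≤ x n) (B : ℝ) (hB : B ∈ upperBounds (bvS x)) (N : ℕ) :
    ∑ i ∈ Finset.range N, x i ≤ B := by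
  have key : ∀ p : ℕ, 2 * ∑ i ∈ Finset.range N, (if i % 2 = p then x i else 0) ≤ B := by
    intro p
    let v : ℕ → ℝ := fun n => if n ∈ Finset.range N then (if n % 2 = p then x n else 0) else 0
    have hz : ∀ n ∉ Finset.range N, v n = 0 := fun n hn => if_neg hn
    have h := bvS_mem x v ?_ (summable_of_ne_finset_zero hz) ?_ ?_
    · have h2 := hB h
      rw [tsum_eq_sum hz] at h2
      have : ∑ i ∈ Finset.range N, v i
          = ∑ i ∈ Finset.range N, (if i % 2 = p then x i else 0) :=
        Finset.sum_congr rfl fun i hi => if_pos hi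
      rwa [this] at h2
    · intro n; have := hx n; simp only [v]; split_ifs <;> linarith
    · intro n; have := hx n; simp only [v]; split_ifs <;> linarith
    · intro n
      by_cases h : n % 2 = p
      · right
        have : ¬ (n + 1) % 2 = p := by omega
        simp [v, this]
      · left; simp [v, h]
  have e : ∑ i ∈ Finset.range N, x i = ∑ i ∈ Finset.range N, (if i % 2 = 0 then x i else 0)
      + ∑ i ∈ Finset.range N, (if i % 2 = 1 then x i else 0) := by
    rw [← Finset.sum_add_distrib]
    refine Finset.sum_congr rfl fun i _ => ?_
    rcases Nat.mod_two_eq_zero_or_one i with h | h <;> simp [h]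
  have := key 0
  have := key 1
  linarith

lemma bvS_upper (x : ℕ → ℝ) (hs : Summable x) : 2 * ∑' n, x n ∈ upperBounds (bvS x) := by
  rintro r ⟨v, hv, hb, hle, rfl⟩
  have hvs : Summable v := Summable.of_nonneg_of_le hv hle hs
  have hs1 : Summable (fun n => v (n + 1)) := (summable_nat_add_iff 1).2 hvs
  have h1 : ∑' n, |v (n + 1) - v n| ≤ ∑' n, (v (n + 1) + v n) := by
    refine hb.tsum_le_tsum (fun n => ?_) (hs1.add hvs)
    have := hv n
    have := hv (n + 1)
    rw [abs_le]; constructor <;> linarith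
  rw [hs1.tsum_add hvs] at h1
  have h2 := hvs.tsum_eq_zero_add
  have h3 := hvs.tsum_le_tsum hle hs
  rw [abs_of_nonneg (hv 0)]
  linarith

/-- A nonnegative sequence of bounded variation is a normal point of the cone `bv₊`
iff it is summable; and then `‖x‖₁ - x₁/2 ≤ sup{‖v‖_bv : v ∈ bv₊, v ≤ x} ≤ 2‖x‖₁`. -/
theorem bv_normal_point_iff_summable
    (x : ℕ → ℝ) (hx : ∀ n, 0 ≤ x n)
    (hbv : Summable (fun n => |x (n + 1) - x n|)) :
    (BddAbove {r : ℝ | ∃ v : ℕ → ℝ, (∀ n, 0 ≤ v n) ∧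
        Summable (fun n => |v (n + 1) - v n|) ∧ (∀ n, v n ≤ x n) ∧
        r = |v 0| + ∑' n, |v (n + 1) - v n|} ↔ Summable x) ∧
    (Summable x →
      (∑' n, x n) - x 0 / 2 ≤
        sSup {r : ℝ | ∃ v : ℕ → ℝ, (∀ n, 0 ≤ v n) ∧
          Summable (fun n => |v (n + 1) - v n|) ∧ (∀ n, v n ≤ x n) ∧
          r = |v 0| + ∑' n, |v (n + 1) - v n|} ∧
      sSup {r : ℝ | ∃ v : ℕ → ℝ, (∀ n, 0 ≤ v n) ∧
          Summable (fun n => |v (n + 1) - v n|) ∧ (∀ n, v n ≤ x n) ∧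
          r = |v 0| + ∑' n, |v (n + 1) - v n|} ≤ 2 * ∑' n, x n) := by
  change (BddAbove (bvS x) ↔ Summable x) ∧ (Summable x → (∑' n, x n) - x 0 / 2 ≤ sSup (bvS x) ∧
    sSup (bvS x) ≤ 2 * ∑' n, x n)
  refine ⟨⟨?_, fun h => ⟨_, bvS_upper x h⟩⟩, fun h => ⟨?_, ?_⟩⟩
  · rintro ⟨B, hB⟩
    exact summable_of_sum_range_le hx (bvS_lower x hx B hB)
  · have h1 : ∑' n, x n ≤ sSup (bvS x) :=
      h.tsum_le_of_sum_range_le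
        (bvS_lower x hx _ fun r hr => le_csSup ⟨_, bvS_upper x h⟩ hr)
    have := hx 0
    linarith
  · exact csSup_le ⟨_, x, hx, hbv, fun _ => le_rfl, rfl⟩ (bvS_upper x h)
end

section
/- Let X be a real normed vector space and X₊ ⊆ X a closed cone. Let B : X₊ → X₊ be positively homogeneous (B(αx) = αB(x) for all α ≥ 0, x ∈ X₊) and bounded, i.e., ‖B‖₊ := sup{‖B(x)‖ : x ∈ X₊, ‖x‖ ≤ 1} < ∞. Then for every x ∈ X₊ and every m ∈ ℕ, limsup_{k→∞} ‖(B^m)^k(x)‖^{1/k} = (limsup_{n→∞} ‖B^n(x)‖^{1/n})^m, where B^n denotes n-fold iteration. -/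
open Metric Filter Topology

theorem aux_lsr (a : ℕ → ℝ) (ha : ∀ n, 0 ≤ a n) (C : ℝ) (hC : 1 ≤ C)
    (hstep : ∀ n, a (n + 1) ≤ C * a n) (m : ℕ) (hm : 0 < m) :
    Filter.limsup (fun k : ℕ => a (m * k) ^ ((k : ℝ)⁻¹)) Filter.atTop =
        (Filter.limsup (fun n : ℕ => a n ^ ((n : ℝ)⁻¹)) Filter.atTop) ^ m := by
  have hC0 : 0 < C := by linarith
  have hm0 : (m : ℝ) ≠ 0 := by positivity
  have hshift : ∀ n j, a (n + j) ≤ C ^ j * a n := by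
    intro n j
    induction j with
    | zero => simp
    | succ j ih =>
      calc a (n + (j + 1)) ≤ C * a (n + j) := hstep (n + j)
        _ ≤ C * (C ^ j * a n) := by gcongr
        _ = C ^ (j + 1) * a n := by ring
  set u : ℕ → ℝ := fun n => a n ^ ((n : ℝ)⁻¹) with hu
  set v : ℕ → ℝ := fun k => a (m * k) ^ ((k : ℝ)⁻¹) with hv
  have hu0 : ∀ n, 0 ≤ u n := fun n => Real.rpow_nonneg (ha n) _
  have hv0 : ∀ n, 0 ≤ v n := fun n => Real.rpow_nonneg (ha _) _
  have huv : ∀ k, v k = u (m * k) ^ m := by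
    intro k
    simp only [hu, hv]
    rw [← Real.rpow_natCast, ← Real.rpow_mul (ha _)]
    congr 1
    push_cast
    rw [mul_inv]
    field_simp
  set A : ℝ := max 1 (a 0) with hA
  have hA1 : 1 ≤ A := le_max_left _ _
  have huD : ∀ n, u n ≤ C * A := by
    intro n
    rcases Nat.eq_zero_or_pos n with rfl | hn
    · simp only [hu]; simp; nlinarith
    · simp only [hu]
      have h1 : a n ≤ (C * A) ^ n := by
        have := hshift 0 n
        rw [zero_add] at this
        calc a n ≤ C ^ n * a 0 := this
          _ ≤ C ^ n * A ^ n := by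
            gcongr
            exact (le_max_right _ _).trans (le_self_pow₀ hA1 hn.ne')
          _ = (C * A) ^ n := by ring
      calc a n ^ ((n : ℝ)⁻¹) ≤ ((C * A) ^ n) ^ ((n : ℝ)⁻¹) :=
            Real.rpow_le_rpow (ha n) h1 (by positivity)
        _ = C * A := Real.pow_rpow_inv_natCast (by positivity) hn.ne'
  have hub : IsBoundedUnder (· ≤ ·) atTop u := isBoundedUnder_of ⟨_, huD⟩
  have huc : IsCoboundedUnder (· ≤ ·) atTop u :=
    (isBoundedUnder_of ⟨0, hu0⟩ : IsBoundedUnder (· ≥ ·) atTop u).isCoboundedUnder_le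
  have hvb : IsBoundedUnder (· ≤ ·) atTop v :=
    isBoundedUnder_of ⟨(C * A) ^ m, fun k => by
      rw [huv]; exact pow_le_pow_left₀ (hu0 _) (huD _) _⟩
  have hvc : IsCoboundedUnder (· ≤ ·) atTop v :=
    (isBoundedUnder_of ⟨0, hv0⟩ : IsBoundedUnder (· ≥ ·) atTop v).isCoboundedUnder_le
  have hL0 : 0 ≤ limsup u atTop :=
    le_limsup_of_frequently_le (Frequently.of_forall hu0) hub
  have hM0 : 0 ≤ limsup v atTop :=
    le_limsup_of_frequently_le (Frequently.of_forall hv0) hvb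
  have htm : Tendsto (fun k : ℕ => m * k) atTop atTop := tendsto_id.const_mul_atTop' hm
  apply le_antisymm
  · have key : ∀ r, limsup u atTop < r → limsup v atTop ≤ r ^ m := by
      intro r hr
      have h1 := eventually_lt_of_limsup_lt hr hub
      refine limsup_le_of_le hvc ?_
      filter_upwards [htm.eventually h1] with k hk
      rw [huv]
      exact pow_le_pow_left₀ (hu0 _) hk.le _
    have ht : Tendsto (fun r : ℝ => r ^ m) (𝓝[>] (limsup u atTop))
        (𝓝 ((limsup u atTop) ^ m)) :=
      ((continuous_pow m).tendsto _).mono_left nhdsWithin_le_nhds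
    exact ge_of_tendsto ht (by filter_upwards [self_mem_nhdsWithin] with r hr using key r hr)
  · have key : ∀ s, (limsup v atTop) ^ ((m : ℝ)⁻¹) < s → limsup u atTop ≤ s := by
      intro s hs
      have hq0 : 0 ≤ (limsup v atTop) ^ ((m : ℝ)⁻¹) := Real.rpow_nonneg hM0 _
      have hs0 : 0 < s := lt_of_le_of_lt hq0 hs
      have hMs : limsup v atTop < s ^ m := by
        have := pow_lt_pow_left₀ hs hq0 hm.ne'
        rwa [Real.rpow_inv_natCast_pow hM0 hm.ne'] at this
      have h1 := eventually_lt_of_limsup_lt hMs hvb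
      have htd : Tendsto (fun n : ℕ => n / m) atTop atTop :=
        Nat.tendsto_div_const_atTop hm.ne'
      set F : ℝ := max 1 (C / s) with hF
      have hF1 : 1 ≤ F := le_max_left _ _
      have hlim : Tendsto (fun n : ℕ => (F ^ m) ^ ((n : ℝ)⁻¹) * s) atTop (𝓝 s) := by
        have h2 : Tendsto (fun n : ℕ => (F ^ m) ^ ((n : ℝ)⁻¹)) atTop (𝓝 ((F ^ m) ^ (0 : ℝ))) :=
          tendsto_const_nhds.rpow tendsto_inv_atTop_nhds_zero_nat (Or.inl (by positivity))
        simpa using h2.mul_const s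
      rw [← hlim.limsup_eq]
      refine limsup_le_limsup ?_ huc hlim.isBoundedUnder_le
      filter_upwards [htd.eventually h1, htd.eventually_gt_atTop 0, eventually_gt_atTop 0]
        with n hn hn' hn0
      have hk : a (m * (n / m)) ≤ s ^ (m * (n / m)) := by
        rw [huv] at hn
        have h3 : u (m * (n / m)) ≤ s := (lt_of_pow_lt_pow_left₀ m hs0.le hn).le
        have h4 := pow_le_pow_left₀ (hu0 _) h3 (m * (n / m))
        simp only [hu] at h4
        rwa [Real.rpow_inv_natCast_pow (ha _) (Nat.mul_pos hm hn').ne'] at h4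
      have h5 : a n ≤ F ^ m * s ^ n := by
        have hdm := Nat.div_add_mod n m
        have h6 := hshift (m * (n / m)) (n % m)
        rw [hdm] at h6
        calc a n ≤ C ^ (n % m) * a (m * (n / m)) := h6
          _ ≤ C ^ (n % m) * s ^ (m * (n / m)) := by gcongr
          _ = (C / s) ^ (n % m) * s ^ n := by
            conv_rhs => rw [← hdm, pow_add]
            rw [hdm, div_pow]
            field_simp
          _ ≤ F ^ (n % m) * s ^ n := by
            gcongr
            exact le_max_right _ _
          _ ≤ F ^ m * s ^ n := by
            gcongr
            · exact (Nat.mod_lt n hm).le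
      calc u n ≤ (F ^ m * s ^ n) ^ ((n : ℝ)⁻¹) :=
            Real.rpow_le_rpow (ha n) h5 (by positivity)
        _ = (F ^ m) ^ ((n : ℝ)⁻¹) * s := by
          rw [Real.mul_rpow (by positivity) (by positivity),
            Real.pow_rpow_inv_natCast hs0.le hn0.ne']
    have h7 := le_of_forall_gt_imp_ge_of_dense key
    have h8 := pow_le_pow_left₀ hL0 h7 m
    rwa [Real.rpow_inv_natCast_pow hM0 hm.ne'] at h8

/-- For a bounded homogeneous map `B : X₊ → X₊` and `x ∈ X₊`,
`γ(x, Bᵐ) = (γ(x, B))ᵐ`, where `γ(x, B) = limsup ‖Bⁿ(x)‖^{1/n}`. -/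
theorem local_spectral_radius_pow
    {X : Type*} [NormedAddCommGroup X] [NormedSpace ℝ X]
    (K : Set X) (hK : IsClosed K) (hconv : Convex ℝ K)
    (hsmul : ∀ α : ℝ, 0 ≤ α → ∀ x ∈ K, α • x ∈ K)
    (hpointed : K ∩ (-K) = {0})
    (B : X → X) (hBK : ∀ x ∈ K, B x ∈ K)
    (hhom : ∀ α : ℝ, 0 ≤ α → ∀ x ∈ K, B (α • x) = α • B x)
    (hbdd : BddAbove {r : ℝ | ∃ x ∈ K, ‖x‖ ≤ 1 ∧ r = ‖B x‖}) :
    ∀ x ∈ K, ∀ m : ℕ, 0 < m →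
      Filter.limsup (fun k : ℕ => ‖(B^[m])^[k] x‖ ^ ((k : ℝ)⁻¹)) Filter.atTop =
        (Filter.limsup (fun n : ℕ => ‖B^[n] x‖ ^ ((n : ℝ)⁻¹)) Filter.atTop) ^ m := by
  intro x hx m hm
  obtain ⟨C, hC⟩ := hbdd
  have hKn : ∀ n, B^[n] x ∈ K := by
    intro n
    induction n with
    | zero => exact hx
    | succ n ih => rw [Function.iterate_succ_apply']; exact hBK _ ih
  have hb : ∀ y ∈ K, ‖B y‖ ≤ max 1 C * ‖y‖ := by
    intro y hy
    have hy1 : y = ‖y‖ • (‖y‖⁻¹ • y) := by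
      by_cases h : y = 0
      · simp [h]
      · rw [smul_smul, mul_inv_cancel₀ (norm_ne_zero_iff.2 h), one_smul]
    have hz : ‖y‖⁻¹ • y ∈ K := hsmul _ (by positivity) y hy
    have hz1 : ‖‖y‖⁻¹ • y‖ ≤ 1 := by
      rw [norm_smul, norm_inv, norm_norm]
      exact inv_mul_le_one
    have h1 : ‖B (‖y‖⁻¹ • y)‖ ≤ C := hC ⟨_, hz, hz1, rfl⟩
    have h2 : B y = ‖y‖ • B (‖y‖⁻¹ • y) := by
      rw [← hhom _ (norm_nonneg y) _ hz, ← hy1]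
    rw [h2, norm_smul, norm_norm, mul_comm]
    exact mul_le_mul_of_nonneg_right (h1.trans (le_max_right _ _)) (norm_nonneg y)
  have := aux_lsr (fun n => ‖B^[n] x‖) (fun n => norm_nonneg _) (max 1 C) (le_max_left _ _)
    (fun n => by
      rw [Function.iterate_succ_apply']
      exact hb _ (hKn n)) m hm
  simpa only [Function.iterate_mul] using this
end

section
/- Let X and Y be real normed vector spaces with closed cones X₊ ⊆ X and Y₊ ⊆ Y and induced partial orders, and let ψ denote the monotone companion half-norm on either space (ψ(x) = d(x, −X₊) on X, ψ(y) = d(y, −Y₊) on Y). Let B : X₊ → Y₊ be positively homogeneous, order-preserving (x ≤ x' implies B(x) ≤ B(x') for x, x' ∈ X₊), and bounded with ‖B‖₊ := sup{‖B(x)‖ : x ∈ X₊, ‖x‖ ≤ 1} < ∞. Then ψ(B(x)) ≤ ‖B‖₊ ψ(x) for all x ∈ X₊. -/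
open Metric Filter Topology

/-- For a bounded, homogeneous, order-preserving map `B : X₊ → Y₊`,
`ψ(B(x)) ≤ ‖B‖₊ · ψ(x)` for all `x ∈ X₊`, where `ψ` is the companion half-norm. -/
theorem half_norm_bound_of_order_preserving
    {X Y : Type*} [NormedAddCommGroup X] [NormedSpace ℝ X]
    [NormedAddCommGroup Y] [NormedSpace ℝ Y]
    (K : Set X) (hK : IsClosed K) (hKconv : Convex ℝ K)
    (hKsmul : ∀ α : ℝ, 0 ≤ α → ∀ x ∈ K, α • x ∈ K)
    (hKpointed : K ∩ (-K) = {0})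
    (L : Set Y) (hL : IsClosed L) (hLconv : Convex ℝ L)
    (hLsmul : ∀ α : ℝ, 0 ≤ α → ∀ y ∈ L, α • y ∈ L)
    (hLpointed : L ∩ (-L) = {0})
    (B : X → Y) (hBK : ∀ x ∈ K, B x ∈ L)
    (hhom : ∀ α : ℝ, 0 ≤ α → ∀ x ∈ K, B (α • x) = α • B x)
    (hmono : ∀ x ∈ K, ∀ y ∈ K, y - x ∈ K → B y - B x ∈ L)
    (hbdd : BddAbove {r : ℝ | ∃ x ∈ K, ‖x‖ ≤ 1 ∧ r = ‖B x‖}) :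
    ∀ x ∈ K, Metric.infDist (B x) (-L) ≤
      sSup {r : ℝ | ∃ x ∈ K, ‖x‖ ≤ 1 ∧ r = ‖B x‖} * Metric.infDist x (-K) := by
  intro x hx
  set S : Set ℝ := {r : ℝ | ∃ x ∈ K, ‖x‖ ≤ 1 ∧ r = ‖B x‖} with hS
  have h0 : (0 : X) ∈ K := by
    have h : (0 : X) ∈ K ∩ (-K) := by rw [hKpointed]; rfl
    exact h.1
  have hM : 0 ≤ sSup S := by
    apply Real.sSup_nonneg
    rintro r ⟨z, _, _, rfl⟩
    exact norm_nonneg _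
  have hnorm : ∀ u ∈ K, ‖B u‖ ≤ sSup S * ‖u‖ := by
    intro u hu
    rcases eq_or_ne u 0 with rfl | hne
    · have := hhom 0 le_rfl 0 h0
      simp only [zero_smul] at this
      simp [this]
    · have hp : 0 < ‖u‖ := norm_pos_iff.mpr hne
      have hi : 0 ≤ ‖u‖⁻¹ := inv_nonneg.mpr hp.le
      have h1 : ‖B (‖u‖⁻¹ • u)‖ ≤ sSup S := by
        apply le_csSup hbdd
        refine ⟨_, hKsmul _ hi u hu, ?_, rfl⟩
        rw [norm_smul, norm_inv, norm_norm, inv_mul_cancel₀ hp.ne']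
      rw [hhom _ hi u hu, norm_smul, norm_inv, norm_norm, inv_mul_le_iff₀ hp] at h1
      linarith
  have key : ∀ z ∈ -K, Metric.infDist (B x) (-L) ≤ sSup S * dist x z := by
    intro z hz
    have hz' : -z ∈ K := hz
    have hxz : x - z ∈ K := by
      have h2 := hKsmul 2 (by norm_num) _
        (hKconv hx hz' (by norm_num : (0 : ℝ) ≤ 1 / 2) (by norm_num : (0 : ℝ) ≤ 1 / 2)
          (by norm_num))
      rw [← smul_add, smul_smul] at h2
      norm_num at h2
      rwa [sub_eq_add_neg]
    have h3 : B (x - z) - B x ∈ L := hmono x hx _ hxz (by simpa using hz')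
    have h4 : B x - B (x - z) ∈ -L := by simpa using h3
    calc Metric.infDist (B x) (-L) ≤ dist (B x) (B x - B (x - z)) :=
          Metric.infDist_le_dist_of_mem h4
      _ = ‖B (x - z)‖ := by rw [dist_eq_norm]; simp
      _ ≤ sSup S * ‖x - z‖ := hnorm _ hxz
      _ = sSup S * dist x z := by rw [dist_eq_norm]
  have hne : (-K).Nonempty := ⟨0, by simpa using h0⟩
  rcases hM.eq_or_lt with h | h
  · have := key 0 (by simpa using h0)
    rw [← h] at this ⊢
    simpa using this
  · rw [← div_le_iff₀' h, Metric.le_infDist hne]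
    intro z hz
    rw [div_le_iff₀' h]
    exact key z hz
end

section
/- Let X and Y be real normed vector spaces with closed cones X₊ ⊆ X and Y₊ ⊆ Y and induced partial orders, and let ♯·♯ denote the monotone companion norm on either space (♯x♯ = max{d(x, −X₊), d(−x, −X₊)}). Let B : X → Y be order-preserving (x ≤ y implies B(x) ≤ B(y) for all x, y ∈ X) and continuous at a point x ∈ X with respect to the original norms. Then B is continuous at x with respect to the monotone companion norms: for every ε > 0 there exists δ > 0 such that ♯B(y) − B(x)♯ < ε whenever y ∈ X and ♯y − x♯ < δ. -/
open Metric Filter Topology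

/-- An order-preserving map that is continuous at `x` with respect to the original norms
is continuous at `x` with respect to the monotone companion norms. -/
theorem companion_continuity_of_order_preserving
    {X Y : Type*} [NormedAddCommGroup X] [NormedSpace ℝ X]
    [NormedAddCommGroup Y] [NormedSpace ℝ Y]
    (K : Set X) (hK : IsClosed K) (hKconv : Convex ℝ K)
    (hKsmul : ∀ α : ℝ, 0 ≤ α → ∀ x ∈ K, α • x ∈ K)
    (hKpointed : K ∩ (-K) = {0})
    (L : Set Y) (hL : IsClosed L) (hLconv : Convex ℝ L)
    (hLsmul : ∀ α : ℝ, 0 ≤ α → ∀ y ∈ L, α • y ∈ L)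
    (hLpointed : L ∩ (-L) = {0})
    (B : X → Y)
    (hmono : ∀ x y : X, y - x ∈ K → B y - B x ∈ L)
    (x : X) (hcont : ContinuousAt B x) :
    ∀ ε : ℝ, 0 < ε → ∃ δ : ℝ, 0 < δ ∧ ∀ y : X,
      max (Metric.infDist (y - x) (-K)) (Metric.infDist (-(y - x)) (-K)) < δ →
      max (Metric.infDist (B y - B x) (-L)) (Metric.infDist (-(B y - B x)) (-L)) < ε := by
  intro ε hε
  obtain ⟨δ, hδ, h⟩ := Metric.continuousAt_iff.1 hcont ε hε
  have h0 : (0 : X) ∈ K := by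
    have : (0 : X) ∈ K ∩ (-K) := by rw [hKpointed]; rfl
    exact this.1
  have hne : (-K).Nonempty := ⟨0, by simpa using h0⟩
  refine ⟨δ, hδ, fun y hy => ?_⟩
  obtain ⟨h1, h2⟩ := max_lt_iff.1 hy
  obtain ⟨z, hz, hzd⟩ := (Metric.infDist_lt_iff hne).1 h1
  obtain ⟨w, hw, hwd⟩ := (Metric.infDist_lt_iff hne).1 h2
  rw [Set.mem_neg] at hz hw
  refine max_lt ?_ ?_
  · have hm := hmono y (y - z) (by rwa [show y - z - y = -z by abel])
    have hc : dist (B (y - z)) (B x) < ε := h (by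
      rw [dist_eq_norm] at hzd ⊢
      rwa [show y - z - x = y - x - z by abel])
    refine lt_of_le_of_lt (Metric.infDist_le_dist_of_mem
      (y := -(B (y - z) - B y)) (by rwa [Set.mem_neg, neg_neg])) ?_
    rw [dist_eq_norm] at hc ⊢
    rwa [show B y - B x - -(B (y - z) - B y) = B (y - z) - B x by abel]
  · have hm := hmono (y + w) y (by rwa [show y - (y + w) = -w by abel])
    have hc : dist (B (y + w)) (B x) < ε := h (by
      rw [dist_eq_norm] at hwd ⊢
      rwa [← norm_neg, show -(y + w - x) = -(y - x) - w by abel])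
    refine lt_of_le_of_lt (Metric.infDist_le_dist_of_mem
      (y := -(B y - B (y + w))) (by rwa [Set.mem_neg, neg_neg])) ?_
    rw [dist_eq_norm] at hc ⊢
    rwa [← norm_neg, show -(-(B y - B x) - -(B y - B (y + w))) = B (y + w) - B x by abel]
end

section
/- Let X be a real normed vector space and X₊ ⊆ X a closed cone, with the partial order x ≤ y iff y − x ∈ X₊ and monotone companion half-norm ψ(x) = d(x, −X₊). Then for every x ∈ X there exists a continuous linear functional x* : X → ℝ that is positive (x*(z) ≥ 0 for all z ∈ X₊), has operator norm ‖x*‖ ≤ 1, and satisfies x*(x) = ψ(x); consequently ψ(x) = max{x*(x) : x* continuous linear, positive, ‖x*‖ ≤ 1}. If moreover x ∈ X₊ and x ≠ 0, such an x* can be chosen with ‖x*‖ = 1. -/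
open Metric Filter Topology

/-- For every `x ∈ X` there is a positive continuous linear functional `x*` with
`‖x*‖ ≤ 1` and `x*(x) = ψ(x)`; consequently `ψ(x)` is the maximum of `x*(x)` over
positive functionals of norm at most one. For `x ∈ X₊`, `x ≠ 0`, one can achieve
`‖x*‖ = 1`. -/
theorem half_norm_dual_representation
    {X : Type*} [NormedAddCommGroup X] [NormedSpace ℝ X]
    (K : Set X) (hK : IsClosed K) (hconv : Convex ℝ K)
    (hsmul : ∀ α : ℝ, 0 ≤ α → ∀ x ∈ K, α • x ∈ K)
    (hpointed : K ∩ (-K) = {0}) :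
    (∀ x : X, ∃ f : X →L[ℝ] ℝ, (∀ z ∈ K, 0 ≤ f z) ∧ ‖f‖ ≤ 1 ∧
      f x = Metric.infDist x (-K)) ∧
    (∀ x : X, IsGreatest
      {r : ℝ | ∃ f : X →L[ℝ] ℝ, (∀ z ∈ K, 0 ≤ f z) ∧ ‖f‖ ≤ 1 ∧ r = f x}
      (Metric.infDist x (-K))) ∧
    (∀ x ∈ K, x ≠ 0 → ∃ f : X →L[ℝ] ℝ, (∀ z ∈ K, 0 ≤ f z) ∧ ‖f‖ = 1 ∧
      f x = Metric.infDist x (-K)) := by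
  have h0 : (0:X) ∈ K := by
    have : (0:X) ∈ K ∩ (-K) := by rw [hpointed]; rfl
    exact this.1
  have hadd : ∀ a ∈ K, ∀ b ∈ K, a + b ∈ K := by
    intro a ha b hb
    have h := hconv ha hb (by norm_num : (0:ℝ) ≤ 1/2) (by norm_num : (0:ℝ) ≤ 1/2) (by norm_num)
    have h2 := hsmul 2 (by norm_num) _ h
    simpa [smul_add, smul_smul] using h2
  have hne : (-K).Nonempty := ⟨0, by simpa using h0⟩
  have hnn : ∀ y : X, 0 ≤ infDist y (-K) := fun y => infDist_nonneg
  have hz : ∀ y ∈ K, infDist (-y) (-K) = 0 := fun y hy =>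
    infDist_zero_of_mem (by simpa using hy)
  have hle : ∀ y : X, infDist y (-K) ≤ ‖y‖ := by
    intro y
    have := infDist_le_dist_of_mem (x := y) (s := -K) (y := 0) (by simpa using h0)
    simpa using this
  have happ : ∀ y : X, ∀ e > 0, ∃ z ∈ K, ‖y + z‖ < infDist y (-K) + e := by
    intro y e he
    obtain ⟨w, hw, hd⟩ := (infDist_lt_iff (x := y) (r := infDist y (-K) + e) hne).1 (by linarith)
    exact ⟨-w, hw, by simpa [dist_eq_norm, sub_eq_add_neg] using hd⟩
  have hlez : ∀ y : X, ∀ z ∈ K, infDist y (-K) ≤ ‖y + z‖ := by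
    intro y z hz
    have := infDist_le_dist_of_mem (x := y) (s := -K) (y := -z) (by simpa using hz)
    simpa [dist_eq_norm] using this
  have Nadd : ∀ x y : X, infDist (x + y) (-K) ≤ infDist x (-K) + infDist y (-K) := by
    intro x y
    refine le_of_forall_pos_le_add fun e he => ?_
    obtain ⟨a, ha, h1⟩ := happ x (e/2) (by linarith)
    obtain ⟨b, hb, h2⟩ := happ y (e/2) (by linarith)
    have h3 := hlez (x + y) (a + b) (hadd a ha b hb)
    have h4 := norm_add_le (x + a) (y + b)
    rw [show x + a + (y + b) = x + y + (a + b) by abel] at h4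
    linarith
  have Nle : ∀ c : ℝ, 0 < c → ∀ x : X, infDist (c • x) (-K) ≤ c * infDist x (-K) := by
    intro c hc x
    refine le_of_forall_pos_le_add fun e he => ?_
    obtain ⟨a, ha, h1⟩ := happ x (e/c) (by positivity)
    have h3 := hlez (c • x) (c • a) (hsmul c hc.le a ha)
    rw [← smul_add, norm_smul, Real.norm_of_nonneg hc.le] at h3
    have h4 := mul_le_mul_of_nonneg_left h1.le hc.le
    rw [mul_add, mul_div_cancel₀ _ hc.ne'] at h4
    linarith
  have Nhom : ∀ c : ℝ, 0 < c → ∀ x : X, infDist (c • x) (-K) = c * infDist x (-K) := by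
    intro c hc x
    refine le_antisymm (Nle c hc x) ?_
    have h := Nle c⁻¹ (by positivity) (c • x)
    rw [smul_smul, inv_mul_cancel₀ hc.ne', one_smul] at h
    have h4 := mul_le_mul_of_nonneg_left h hc.le
    rwa [← mul_assoc, mul_inv_cancel₀ hc.ne', one_mul] at h4
  have main : ∀ x : X, ∃ f : X →L[ℝ] ℝ, (∀ z ∈ K, 0 ≤ f z) ∧ ‖f‖ ≤ 1 ∧
      f x = Metric.infDist x (-K) := by
    intro x
    by_cases hx : x = 0
    · subst hx
      refine ⟨0, by simp, by simp, ?_⟩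
      have := hz 0 h0
      simpa using this.symm
    obtain ⟨g, hg1, hg2⟩ := exists_extension_of_le_sublinear
      (LinearPMap.mkSpanSingleton (K := ℝ) x (infDist x (-K)) hx)
      (fun y => infDist y (-K)) Nhom Nadd (by
        rintro ⟨y, hy⟩
        obtain ⟨c, rfl⟩ := Submodule.mem_span_singleton.1 hy
        erw [LinearPMap.mkSpanSingleton'_apply]
        rcases lt_or_ge 0 c with hc | hc
        · simp [Nhom c hc x]
        · exact le_trans (mul_nonpos_of_nonpos_of_nonneg hc (hnn x)) (hnn _))
    have hgb : ∀ y, ‖g y‖ ≤ 1 * ‖y‖ := by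
      intro y
      rw [Real.norm_eq_abs, abs_le, one_mul]
      have h1 := (hg2 y).trans (hle y)
      have h2 := (hg2 (-y)).trans (hle (-y))
      rw [map_neg, norm_neg] at h2
      constructor <;> linarith
    refine ⟨g.mkContinuous 1 hgb, ?_, g.mkContinuous_norm_le zero_le_one hgb, ?_⟩
    · intro z hzK
      have h := hg2 (-z)
      simp only [hz z hzK, map_neg] at h
      simpa using h
    · have h := hg1 ⟨x, Submodule.mem_span_singleton_self x⟩
      rw [LinearPMap.mkSpanSingleton_apply] at h
      simpa using h
  refine ⟨main, fun x => ⟨?_, ?_⟩, ?_⟩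
  · obtain ⟨f, h1, h2, h3⟩ := main x
    exact ⟨f, h1, h2, h3.symm⟩
  · rintro r ⟨f, h1, h2, rfl⟩
    refine le_of_forall_pos_le_add fun e he => ?_
    obtain ⟨a, ha, h⟩ := happ x e he
    have h3 := (le_abs_self _).trans (f.le_of_opNorm_le h2 (x + a))
    rw [map_add] at h3
    have := h1 a ha
    linarith
  · intro x hx hx0
    obtain ⟨f, h1, h2, h3⟩ := main x
    refine ⟨f, h1, le_antisymm h2 ?_, h3⟩
    have hpos : 0 < infDist x (-K) := by
      refine (hK.neg.notMem_iff_infDist_pos hne).1 fun hm => hx0 ?_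
      have : x ∈ K ∩ (-K) := ⟨hx, hm⟩
      rw [hpointed] at this
      exact this
    have key : infDist x (-K) ≤ ‖f‖ * infDist x (-K) := by
      refine le_of_forall_pos_le_add fun e he => ?_
      obtain ⟨a, ha, h⟩ := happ x e he
      have h4 := (le_abs_self _).trans (f.le_opNorm (x + a))
      rw [map_add, h3] at h4
      have := h1 a ha
      nlinarith [norm_nonneg f, mul_le_mul_of_nonneg_left h.le (norm_nonneg f)]
    by_contra! hlt
    nlinarith
end

section
/- Let X be a real Banach space and X₊ ⊆ X a closed cone, with the partial order x ≤ y iff y − x ∈ X₊. Let 0 < b < ∞ and for 0 ≤ s ≤ t ≤ b let K(t, s) : X → X be bounded linear positive operators (K(t,s)(X₊) ⊆ X₊) such that for each x ∈ X the map (t, s) ↦ K(t, s)x is continuous on {(t,s) : 0 ≤ s ≤ t ≤ b}. Let u : [0, b] → X be continuous and satisfy u(t) ≥ ∫₀ᵗ K(t, s)u(s) ds for all t ∈ [0, b] (i.e., u(t) − ∫₀ᵗ K(t,s)u(s)ds ∈ X₊). Then u(t) ∈ X₊ for all t ∈ [0, b]. -/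
open Metric Filter Topology MeasureTheory intervalIntegral

lemma aux_map {X : Type*} [NormedAddCommGroup X] [NormedSpace ℝ X] (K : Set X) (h0 : (0:X) ∈ K)
    (L : X →L[ℝ] X) (hL : ∀ x ∈ K, L x ∈ K) (M : ℝ) (hM0 : 0 ≤ M) (hM : ‖L‖ ≤ M) (x : X) :
    infDist (L x) K ≤ M * infDist x K := by
  have : Nonempty K := ⟨⟨0, h0⟩⟩
  rw [infDist_eq_iInf (x := x), Real.mul_iInf_of_nonneg hM0]
  refine le_ciInf fun y => ?_
  refine (infDist_le_dist_of_mem (hL y y.2)).trans ?_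
  rw [dist_eq_norm, dist_eq_norm, ← map_sub]
  exact L.le_of_opNorm_le hM _

lemma aux_add {X : Type*} [NormedAddCommGroup X] [NormedSpace ℝ X] (K : Set X) (h0 : (0:X) ∈ K)
    (hadd : ∀ x ∈ K, ∀ y ∈ K, x + y ∈ K) (x y : X) :
    infDist (x + y) K ≤ infDist x K + infDist y K := by
  have hne : K.Nonempty := ⟨0, h0⟩
  have h : infDist (x + y) K - infDist x K ≤ infDist y K := by
    refine (le_infDist hne).2 fun {z} hz => ?_
    have : infDist (x + y) K - dist y z ≤ infDist x K := by
      refine (le_infDist hne).2 fun {w} hw => ?_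
      have h1 := infDist_le_dist_of_mem (x := x + y) (hadd w hw z hz)
      have h2 := dist_add_add_le x y w z
      linarith
    linarith
  linarith

/-- Positivity of continuous solutions of the abstract integral inequality
`u(t) ≥ ∫₀ᵗ K(t,s) u(s) ds` with positive kernel operators. -/
theorem positivity_of_integral_inequality
    {X : Type*} [NormedAddCommGroup X] [NormedSpace ℝ X] [CompleteSpace X]
    (K : Set X) (hK : IsClosed K) (hconv : Convex ℝ K)
    (hsmul : ∀ α : ℝ, 0 ≤ α → ∀ x ∈ K, α • x ∈ K)
    (hpointed : K ∩ (-K) = {0})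
    (b : ℝ) (hb : 0 < b)
    (k : ℝ → ℝ → X →L[ℝ] X)
    (hkpos : ∀ t s : ℝ, 0 ≤ s → s ≤ t → t ≤ b → ∀ x ∈ K, k t s x ∈ K)
    (hkcont : ∀ x : X, ContinuousOn (fun p : ℝ × ℝ => k p.1 p.2 x)
      {p : ℝ × ℝ | 0 ≤ p.2 ∧ p.2 ≤ p.1 ∧ p.1 ≤ b})
    (u : ℝ → X) (hu : ContinuousOn u (Set.Icc 0 b))
    (hineq : ∀ t ∈ Set.Icc (0 : ℝ) b,
      u t - ∫ s in (0 : ℝ)..t, k t s (u s) ∈ K) :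
    ∀ t ∈ Set.Icc (0 : ℝ) b, u t ∈ K := by
  have h0 : (0:X) ∈ K := by
    have : (0:X) ∈ K ∩ (-K) := by rw [hpointed]; rfl
    exact this.1
  have hadd : ∀ x ∈ K, ∀ y ∈ K, x + y ∈ K := by
    intro x hx y hy
    have := hsmul 2 (by norm_num) _
      (hconv hx hy (a := 1/2) (b := 1/2) (by norm_num) (by norm_num) (by norm_num))
    rw [smul_add, smul_smul, smul_smul] at this
    norm_num at this
    exact this
  have hsm : ∀ (a : ℝ) (x : X), 0 ≤ a → infDist (a • x) K ≤ a * infDist x K := by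
    intro a x ha
    have := aux_map K h0 (a • ContinuousLinearMap.id ℝ X) (fun x hx => by simpa using hsmul a ha x hx) a ha
      (by
        rw [norm_smul, Real.norm_of_nonneg ha]
        exact mul_le_of_le_one_right ha ContinuousLinearMap.norm_id_le) x
    simpa using this
  have hcvx : ConvexOn ℝ Set.univ (fun x : X => infDist x K) := by
    refine ⟨convex_univ, fun x _ y _ a c ha hc _ => ?_⟩
    exact (aux_add K h0 hadd _ _).trans (add_le_add (hsm a x ha) (hsm c y hc))
  obtain ⟨M, hM⟩ : ∃ M : ℝ, ∀ t s : ℝ, 0 ≤ s → s ≤ t → t ≤ b → ‖k t s‖ ≤ M := by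
    have hcomp : IsCompact {p : ℝ × ℝ | 0 ≤ p.2 ∧ p.2 ≤ p.1 ∧ p.1 ≤ b} := by
      refine (isCompact_Icc (a := ((0:ℝ),(0:ℝ))) (b := (b, b))).of_isClosed_subset ?_ ?_
      · exact (isClosed_le continuous_const continuous_snd).inter
          ((isClosed_le continuous_snd continuous_fst).inter
            (isClosed_le continuous_fst continuous_const))
      · rintro ⟨t, s⟩ ⟨h1, h2, h3⟩
        simp only at h1 h2 h3
        exact ⟨⟨h1.trans h2, h1⟩, ⟨h3, h2.trans h3⟩⟩
    obtain ⟨C, hC⟩ := banach_steinhaus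
      (g := fun p : {p : ℝ × ℝ | 0 ≤ p.2 ∧ p.2 ≤ p.1 ∧ p.1 ≤ b} => k p.1.1 p.1.2) (by
        intro x
        obtain ⟨C, hC⟩ := hcomp.exists_bound_of_continuousOn (hkcont x)
        exact ⟨C, fun p => hC p.1 p.2⟩)
    exact ⟨C, fun t s h1 h2 h3 => hC ⟨(t, s), h1, h2, h3⟩⟩
  have hM0 : 0 ≤ M := (norm_nonneg _).trans (hM 0 0 le_rfl le_rfl hb.le)
  set ψ : ℝ → ℝ := fun t => infDist (u (max 0 (min b t))) K with hψ
  have hψc : Continuous ψ := by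
    refine (continuous_infDist_pt K).comp (hu.comp_continuous (by fun_prop) fun t => ?_)
    exact ⟨le_max_left _ _, max_le hb.le (min_le_left _ _)⟩
  have hψe : ∀ t ∈ Set.Icc (0:ℝ) b, ψ t = infDist (u t) K := by
    intro t ht
    simp only [hψ, min_eq_right ht.2, max_eq_right ht.1]
  have hψ0 : ∀ t, 0 ≤ ψ t := fun t => infDist_nonneg
  have key : ∀ t ∈ Set.Icc (0:ℝ) b, ψ t ≤ M * ∫ s in (0:ℝ)..t, ψ s := by
    intro t ht
    rw [hψe t ht]
    have hI : 0 ≤ M * ∫ s in (0:ℝ)..t, ψ s :=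
      mul_nonneg hM0 (integral_nonneg ht.1 fun s _ => hψ0 s)
    have h1 : infDist (u t) K ≤ infDist (∫ s in (0 : ℝ)..t, k t s (u s)) K := by
      have := aux_add K h0 hadd (u t - ∫ s in (0 : ℝ)..t, k t s (u s)) (∫ s in (0 : ℝ)..t, k t s (u s))
      rw [sub_add_cancel, infDist_zero_of_mem (hineq t ht), zero_add] at this
      exact this
    refine h1.trans ?_
    have hz : infDist (0:X) K = 0 := infDist_zero_of_mem h0
    rcases ht.1.eq_or_lt with h | htpos
    · subst h; simp [hz]
    by_cases hint : IntegrableOn (fun s => k t s (u s)) (Set.Ioc 0 t)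
    · have hdi : IntegrableOn (fun s => infDist (k t s (u s)) K) (Set.Ioc 0 t) := by
        refine Integrable.mono hint
          ((continuous_infDist_pt K).comp_aestronglyMeasurable hint.aestronglyMeasurable) ?_
        refine Eventually.of_forall fun s => ?_
        rw [Real.norm_of_nonneg infDist_nonneg]
        simpa using infDist_le_dist_of_mem (x := k t s (u s)) h0
      have hJ := hcvx.map_set_average_le (μ := volume) (t := Set.Ioc 0 t)
        (f := fun s => k t s (u s)) (continuous_infDist_pt K).continuousOn isClosed_univ
        (by simp [htpos]) (by simp) (Eventually.of_forall fun s => Set.mem_univ _) hint hdi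
      rw [setAverage_eq, setAverage_eq] at hJ
      simp only [Real.volume_real_Ioc_of_le ht.1, sub_zero, smul_eq_mul] at hJ
      rw [integral_of_le ht.1, integral_of_le ht.1]
      have h2 := hsm t (t⁻¹ • ∫ s in Set.Ioc 0 t, k t s (u s)) ht.1
      rw [smul_smul, mul_inv_cancel₀ htpos.ne', one_smul] at h2
      refine h2.trans ((mul_le_mul_of_nonneg_left hJ ht.1).trans ?_)
      rw [← mul_assoc, mul_inv_cancel₀ htpos.ne', one_mul, ← MeasureTheory.integral_const_mul]
      refine setIntegral_mono_on hdi ?_ measurableSet_Ioc fun s hs => ?_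
      · exact ((continuous_const.mul hψc).integrableOn_Icc).mono_set Set.Ioc_subset_Icc_self
      · rw [hψe s ⟨hs.1.le, hs.2.trans ht.2⟩]
        exact aux_map K h0 _ (hkpos t s hs.1.le hs.2 ht.2) M hM0 (hM t s hs.1.le hs.2 ht.2) _
    · rw [integral_of_le ht.1, MeasureTheory.integral_undef hint, hz]
      exact hI
  have hder : ∀ t, HasDerivAt (fun t => ∫ s in (0:ℝ)..t, ψ s) (ψ t) t := fun t =>
    integral_hasDerivAt_right (hψc.intervalIntegrable _ _)
      (hψc.stronglyMeasurableAtFilter _ _) hψc.continuousAt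
  have hG := norm_le_gronwallBound_of_norm_deriv_right_le (f := fun t => ∫ s in (0:ℝ)..t, ψ s)
    (f' := ψ) (δ := 0) (K := M) (ε := 0) (a := 0) (b := b)
    (fun t _ => (hder t).continuousAt.continuousWithinAt)
    (fun t _ => (hder t).hasDerivWithinAt) (by simp) (by
      intro t ht
      rw [Real.norm_of_nonneg (hψ0 t),
        Real.norm_of_nonneg (integral_nonneg ht.1 fun s _ => hψ0 s), add_zero]
      exact key t ⟨ht.1, ht.2.le⟩)
  intro t ht
  have h1 := hG t ht
  rw [gronwallBound_ε0_δ0] at h1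
  have h2 := key t ht
  rw [norm_le_zero_iff.1 h1, mul_zero, hψe t ht] at h2
  exact (hK.mem_iff_infDist_zero ⟨0, h0⟩).2 (le_antisymm h2 infDist_nonneg)
end

section
/- Let X be a real normed vector space and X₊ ⊆ X a closed cone that is complete as a metric subspace of X, with the partial order x ≤ y iff y − x ∈ X₊ and monotone companion norm ♯x♯ = max{d(x, −X₊), d(−x, −X₊)}. Let B : X₊ → X₊ be positively homogeneous, order-preserving, bounded (‖B‖₊ := sup{‖B(x)‖ : x ∈ X₊, ‖x‖ ≤ 1} < ∞), and continuous with respect to the original norm. If r > 0 satisfies limsup_{n→∞} ‖Bⁿ(x)‖^{1/n} < r for every x ∈ X₊, then inf_{n∈ℕ} (♯Bⁿ♯₊)^{1/n} ≤ r, where ♯Bⁿ♯₊ := sup{♯Bⁿ(x)♯ : x ∈ X₊, ♯x♯ ≤ 1}. In other words, the companion cone spectral radius of B is at most its orbital spectral radius. -/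
open Metric Filter Topology

/-- If the cone is complete and `B : X₊ → X₊` is homogeneous, order-preserving,
bounded, and continuous, then the companion cone spectral radius of `B` is bounded
by any `r > 0` dominating all orbital growth factors `limsup ‖Bⁿ(x)‖^{1/n}`. -/
theorem companion_cone_spectral_radius_le_orbital
    {X : Type*} [NormedAddCommGroup X] [NormedSpace ℝ X]
    (K : Set X) (hK : IsClosed K) (hconv : Convex ℝ K)
    (hsmul : ∀ α : ℝ, 0 ≤ α → ∀ x ∈ K, α • x ∈ K)
    (hpointed : K ∩ (-K) = {0})
    (hcomplete : IsComplete K)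
    (B : X → X) (hBK : ∀ x ∈ K, B x ∈ K)
    (hhom : ∀ α : ℝ, 0 ≤ α → ∀ x ∈ K, B (α • x) = α • B x)
    (hmono : ∀ x ∈ K, ∀ y ∈ K, y - x ∈ K → B y - B x ∈ K)
    (hbdd : BddAbove {r : ℝ | ∃ x ∈ K, ‖x‖ ≤ 1 ∧ r = ‖B x‖})
    (hcont : ContinuousOn B K)
    (r : ℝ) (hr : 0 < r)
    (horb : ∀ x ∈ K,
      Filter.limsup (fun n : ℕ => ‖B^[n] x‖ ^ ((n : ℝ)⁻¹)) Filter.atTop < r) :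
    ⨅ n : ℕ, (sSup {s : ℝ | ∃ x ∈ K,
        max (Metric.infDist x (-K)) (Metric.infDist (-x) (-K)) ≤ 1 ∧
        s = max (Metric.infDist (B^[n + 1] x) (-K))
          (Metric.infDist (-(B^[n + 1] x)) (-K))}) ^ (((n : ℝ) + 1)⁻¹) ≤ r := by
  have h0 : (0 : X) ∈ K := by
    have : (0 : X) ∈ K ∩ (-K) := by rw [hpointed]; rfl
    exact this.1
  have hadd : ∀ x ∈ K, ∀ y ∈ K, x + y ∈ K := by
    intro x hx y hy
    have h1 := hconv hx hy (a := 1 / 2) (b := 1 / 2) (by norm_num) (by norm_num) (by norm_num)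
    have h2 := hsmul 2 (by norm_num) _ h1
    have h3 : (2 : ℝ) • ((1 / 2 : ℝ) • x + (1 / 2 : ℝ) • y) = x + y := by
      rw [smul_add, smul_smul, smul_smul]; norm_num
    rwa [h3] at h2
  have hmaps : Set.MapsTo B K K := hBK
  have hitK : ∀ n : ℕ, ∀ x ∈ K, B^[n] x ∈ K := fun n x hx => hmaps.iterate n hx
  have hithom : ∀ n : ℕ, ∀ α : ℝ, 0 ≤ α → ∀ x ∈ K, B^[n] (α • x) = α • B^[n] x := by
    intro n
    induction n with
    | zero => intros; rfl
    | succ n ih =>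
      intro α hα x hx
      rw [Function.iterate_succ_apply', Function.iterate_succ_apply', ih α hα x hx,
        hhom α hα _ (hitK n x hx)]
  have hitmono : ∀ n : ℕ, ∀ x ∈ K, ∀ y ∈ K, y - x ∈ K → B^[n] y - B^[n] x ∈ K := by
    intro n
    induction n with
    | zero => intro x _ y _ h; exact h
    | succ n ih =>
      intro x hx y hy h
      rw [Function.iterate_succ_apply', Function.iterate_succ_apply']
      exact hmono _ (hitK n x hx) _ (hitK n y hy) (ih x hx y hy h)
  have hitcont : ∀ n : ℕ, ContinuousOn B^[n] K := fun n => hcont.iterate hmaps n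
  -- norm bound
  obtain ⟨M, hM1, hM⟩ : ∃ M : ℝ, 1 ≤ M ∧ ∀ x ∈ K, ‖B x‖ ≤ M * ‖x‖ := by
    obtain ⟨M, hM⟩ := hbdd
    refine ⟨max M 1, le_max_right _ _, fun x hx => ?_⟩
    by_cases hx0 : x = 0
    · subst hx0
      have := hhom 0 le_rfl 0 h0
      simp at this
      simp [this]
    · have hpos : 0 < ‖x‖ := norm_pos_iff.mpr hx0
      have h1 : ‖B (‖x‖⁻¹ • x)‖ ≤ M := by
        apply hM
        refine ⟨_, hsmul _ (by positivity) x hx, ?_, rfl⟩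
        rw [norm_smul, norm_inv, norm_norm, inv_mul_cancel₀ hpos.ne']
      rw [hhom _ (by positivity) x hx, norm_smul, norm_inv, norm_norm,
        inv_mul_le_iff₀ hpos] at h1
      calc ‖B x‖ ≤ ‖x‖ * M := h1
        _ ≤ max M 1 * ‖x‖ := by rw [mul_comm]; gcongr; exact le_max_left _ _
  have hMn : ∀ n : ℕ, ∀ x ∈ K, ‖B^[n] x‖ ≤ M ^ n * ‖x‖ := by
    intro n
    induction n with
    | zero => intro x _; simp
    | succ n ih =>
      intro x hx
      rw [Function.iterate_succ_apply']
      calc _ ≤ M * ‖B^[n] x‖ := hM _ (hitK n x hx)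
        _ ≤ M * (M ^ n * ‖x‖) := by gcongr; exact ih x hx
        _ = _ := by ring
  -- orbits bounded
  have horb2 : ∀ x ∈ K, ∃ m : ℕ, ∀ n : ℕ, ‖B^[n] x‖ ≤ m * r ^ n := by
    intro x hx
    have hb : IsBoundedUnder (· ≤ ·) atTop (fun n : ℕ => ‖B^[n] x‖ ^ ((n : ℝ)⁻¹)) := by
      refine isBoundedUnder_of_eventually_le (a := M * max 1 ‖x‖) ?_
      filter_upwards [eventually_ge_atTop 1] with n hn
      have hn' : (n : ℕ) ≠ 0 := by omega
      have hc : (1 : ℝ) ≤ max 1 ‖x‖ := le_max_left _ _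
      rw [Real.rpow_inv_le_iff_of_pos (norm_nonneg _) (by positivity) (by positivity),
        Real.rpow_natCast, mul_pow]
      refine (hMn n x hx).trans ?_
      gcongr
      exact (le_max_right 1 ‖x‖).trans (le_self_pow₀ hc hn')
    have hev := eventually_lt_of_limsup_lt (horb x hx) hb
    obtain ⟨N, hN⟩ := eventually_atTop.1 hev
    obtain ⟨m, hm⟩ := exists_nat_ge
      (1 + ∑ i ∈ Finset.range (N + 1), ‖B^[i] x‖ / r ^ i)
    refine ⟨m, fun n => ?_⟩
    have hsum : 0 ≤ ∑ i ∈ Finset.range (N + 1), ‖B^[i] x‖ / r ^ i :=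
      Finset.sum_nonneg (fun i _ => by positivity)
    rw [← div_le_iff₀ (by positivity)]
    by_cases hn : n < N + 1
    · have := Finset.single_le_sum (f := fun i => ‖B^[i] x‖ / r ^ i)
        (fun i _ => by positivity) (Finset.mem_range.2 hn)
      linarith
    · have h1 := (hN n (by omega)).le
      have hnp : 0 < n := by omega
      rw [Real.rpow_inv_le_iff_of_pos (norm_nonneg _) hr.le (by positivity),
        Real.rpow_natCast] at h1
      have : ‖B^[n] x‖ / r ^ n ≤ 1 := by
        rw [div_le_one (by positivity)]; exact h1
      linarith
  -- Baire
  obtain ⟨m, x0, hx0, ε, hε, hball⟩ : ∃ m : ℕ, ∃ x0 ∈ K, ∃ ε > 0, ∀ y ∈ K, ‖y - x0‖ < ε →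
      ∀ n : ℕ, ‖B^[n] y‖ ≤ m * r ^ n := by
    haveI : CompleteSpace K := hcomplete.completeSpace_coe
    haveI : Nonempty K := ⟨⟨0, h0⟩⟩
    let A : ℕ → Set K := fun m => {x | ∀ n : ℕ, ‖B^[n] (x : X)‖ ≤ m * r ^ n}
    have hA : ∀ m, IsClosed (A m) := by
      intro m
      have : A m = ⋂ n : ℕ, {x : K | ‖B^[n] (x : X)‖ ≤ m * r ^ n} := by
        ext x; simp [A]
      rw [this]
      refine isClosed_iInter fun n => isClosed_le ?_ continuous_const
      exact (continuousOn_iff_continuous_restrict.1 (hitcont n)).norm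
    have hU : ⋃ m, A m = Set.univ := by
      ext x
      simp only [Set.mem_iUnion, Set.mem_univ, iff_true]
      exact horb2 x x.2
    obtain ⟨m, x0, hx0⟩ := nonempty_interior_of_iUnion_of_closed hA hU
    obtain ⟨ε, hε, hb⟩ := Metric.mem_nhds_iff.1 (mem_interior_iff_mem_nhds.1 hx0)
    refine ⟨m, x0, x0.2, ε, hε, fun y hy hyx => ?_⟩
    have : (⟨y, hy⟩ : K) ∈ A m := by
      apply hb
      rw [Metric.mem_ball, Subtype.dist_eq, dist_eq_norm]
      exact hyx
    exact this
  have h0n : (0 : X) ∈ -K := by simpa using h0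
  have hdle : ∀ u v : X, v - u ∈ K → infDist u (-K) ≤ ‖v‖ := by
    intro u v h
    have h1 : -(v - u) ∈ -K := by simpa using h
    refine (infDist_le_dist_of_mem h1).trans ?_
    rw [dist_eq_norm]
    simp
  set c : ℝ := ε / 2 with hc
  have hcpos : 0 < c := by positivity
  have hkey : ∀ n : ℕ, ∀ x ∈ K, infDist x (-K) ≤ 1 →
      infDist (B^[n] x) (-K) ≤ (c / 2)⁻¹ * (m * r ^ n) := by
    intro n x hx hx1
    obtain ⟨k, hk, hxk⟩ := (infDist_lt_iff ⟨0, h0n⟩).1 (lt_of_le_of_lt hx1 one_lt_two)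
    have hk' : -k ∈ K := hk
    have hd : (0 : ℝ) ≤ c / 2 := by positivity
    have hz : (c / 2) • (x + -k) ∈ K := hsmul _ hd _ (hadd _ hx _ hk')
    have hy : x0 + (c / 2) • (x + -k) ∈ K := hadd _ hx0 _ hz
    have hyn := hball _ hy (by
      rw [add_sub_cancel_left, norm_smul, Real.norm_of_nonneg hd, ← sub_eq_add_neg,
        ← dist_eq_norm]
      nlinarith) n
    have hle := hitmono n ((c / 2) • x) (hsmul _ hd _ hx) _ hy (by
      have : x0 + (c / 2) • (x + -k) - (c / 2) • x = x0 + (c / 2) • (-k) := by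
        rw [smul_add]; abel
      rw [this]
      exact hadd _ hx0 _ (hsmul _ hd _ hk'))
    rw [hithom n _ hd x hx] at hle
    have hle2 := hsmul (c / 2)⁻¹ (by positivity) _ hle
    rw [smul_sub, smul_smul, inv_mul_cancel₀ (by positivity), one_smul] at hle2
    refine (hdle _ _ hle2).trans ?_
    rw [norm_smul, Real.norm_of_nonneg (by positivity)]
    gcongr
  set C : ℝ := (c / 2)⁻¹ * m + 1 with hC
  have hCpos : 0 < C := by positivity
  set f : ℕ → ℝ := fun n : ℕ => (sSup {s : ℝ | ∃ x ∈ K,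
        max (Metric.infDist x (-K)) (Metric.infDist (-x) (-K)) ≤ 1 ∧
        s = max (Metric.infDist (B^[n + 1] x) (-K))
          (Metric.infDist (-(B^[n + 1] x)) (-K))}) ^ (((n : ℝ) + 1)⁻¹) with hf
  have hsnn : ∀ n : ℕ, 0 ≤ sSup {s : ℝ | ∃ x ∈ K,
        max (Metric.infDist x (-K)) (Metric.infDist (-x) (-K)) ≤ 1 ∧
        s = max (Metric.infDist (B^[n + 1] x) (-K))
          (Metric.infDist (-(B^[n + 1] x)) (-K))} := by
    intro n
    apply Real.sSup_nonneg
    rintro s ⟨x, _, _, rfl⟩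
    exact le_max_of_le_left infDist_nonneg
  have hbelow : BddBelow (Set.range f) := by
    refine ⟨0, ?_⟩
    rintro _ ⟨n, rfl⟩
    exact Real.rpow_nonneg (hsnn n) _
  have hfle : ∀ n : ℕ, f n ≤ C ^ (((n : ℝ) + 1)⁻¹) * r := by
    intro n
    have h1 : sSup {s : ℝ | ∃ x ∈ K,
        max (Metric.infDist x (-K)) (Metric.infDist (-x) (-K)) ≤ 1 ∧
        s = max (Metric.infDist (B^[n + 1] x) (-K))
          (Metric.infDist (-(B^[n + 1] x)) (-K))} ≤ C * r ^ (n + 1) := by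
      apply Real.sSup_le _ (by positivity)
      rintro s ⟨x, hx, hx1, rfl⟩
      have hpos : 0 < r ^ (n + 1) := by positivity
      apply max_le
      · have := hkey (n + 1) x hx ((le_max_left _ _).trans hx1)
        rw [hC]
        linarith
      · rw [infDist_zero_of_mem (by simpa using hitK (n + 1) x hx)]
        positivity
    calc f n ≤ (C * r ^ (n + 1)) ^ (((n : ℝ) + 1)⁻¹) :=
          Real.rpow_le_rpow (hsnn n) h1 (by positivity)
      _ = C ^ (((n : ℝ) + 1)⁻¹) * r := by
          rw [Real.mul_rpow hCpos.le (by positivity)]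
          congr 1
          have := Real.pow_rpow_inv_natCast hr.le (Nat.succ_ne_zero n)
          push_cast at this
          exact this
  have hlim : Tendsto (fun n : ℕ => C ^ (((n : ℝ) + 1)⁻¹) * r) atTop (𝓝 r) := by
    have h1 : Tendsto (fun n : ℕ => ((n : ℝ) + 1)⁻¹) atTop (𝓝 0) := by
      simpa using tendsto_one_div_add_atTop_nhds_zero_nat (𝕜 := ℝ)
    have h2 := ((Real.continuousAt_const_rpow hCpos.ne').tendsto.comp h1).mul_const r
    simpa using h2
  exact ge_of_tendsto' hlim (fun n => (ciInf_le hbelow n).trans (hfle n))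
end

section
/- Let X be a real normed vector space and X₊ ⊆ X a closed cone, with the partial order x ≤ y iff y − x ∈ X₊. Let B : X₊ → X₊ be positively homogeneous, order-preserving, and bounded (‖B‖₊ := sup{‖B(x)‖ : x ∈ X₊, ‖x‖ ≤ 1} < ∞). Let u ∈ X₊ be a normal point of X₊ (i.e., for every v ∈ X₊, {‖x‖ : x ∈ X₊, x ≤ v} is bounded; it suffices that {‖x‖ : x ∈ X₊, x ≤ u} is bounded), and suppose α ≥ 0 and k ∈ ℕ satisfy B^k(u) ≤ α^k u. Then γ_B(u) := limsup_{n→∞} ‖Bⁿ(u)‖^{1/n} ≤ α. -/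
open Metric Filter Topology

/-- If `B : X₊ → X₊` is homogeneous, order-preserving, bounded, `u ∈ X₊` is a normal
point, and `Bᵏ(u) ≤ αᵏ u`, then `γ_B(u) = limsup ‖Bⁿ(u)‖^{1/n} ≤ α`. -/
theorem orbital_growth_le_of_normal_point
    {X : Type*} [NormedAddCommGroup X] [NormedSpace ℝ X]
    (K : Set X) (hK : IsClosed K) (hconv : Convex ℝ K)
    (hsmul : ∀ α : ℝ, 0 ≤ α → ∀ x ∈ K, α • x ∈ K)
    (hpointed : K ∩ (-K) = {0})
    (B : X → X) (hBK : ∀ x ∈ K, B x ∈ K)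
    (hhom : ∀ α : ℝ, 0 ≤ α → ∀ x ∈ K, B (α • x) = α • B x)
    (hmono : ∀ x ∈ K, ∀ y ∈ K, y - x ∈ K → B y - B x ∈ K)
    (hbdd : BddAbove {r : ℝ | ∃ x ∈ K, ‖x‖ ≤ 1 ∧ r = ‖B x‖})
    (u : X) (hu : u ∈ K)
    (hnormalpt : BddAbove {r : ℝ | ∃ x ∈ K, u - x ∈ K ∧ r = ‖x‖})
    (α : ℝ) (hα : 0 ≤ α) (k : ℕ) (hk : 0 < k)
    (hBk : α ^ k • u - B^[k] u ∈ K) :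
    Filter.limsup (fun n : ℕ => ‖B^[n] u‖ ^ ((n : ℝ)⁻¹)) Filter.atTop ≤ α := by
  have hadd : ∀ x ∈ K, ∀ y ∈ K, x + y ∈ K := by
    intro x hx y hy
    have h := hconv hx hy (a := 1/2) (b := 1/2) (by norm_num) (by norm_num) (by norm_num)
    have h2 := hsmul 2 (by norm_num) _ h
    rw [smul_add, smul_smul, smul_smul] at h2
    norm_num at h2
    exact h2
  have hitK : ∀ n : ℕ, ∀ x ∈ K, B^[n] x ∈ K := by
    intro n
    induction n with
    | zero => intro x hx; simpa using hx
    | succ n ih => intro x hx; rw [Function.iterate_succ_apply]; exact ih _ (hBK x hx)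
  have hithom : ∀ n : ℕ, ∀ a : ℝ, 0 ≤ a → ∀ x ∈ K, B^[n] (a • x) = a • B^[n] x := by
    intro n
    induction n with
    | zero => intro a ha x hx; simp
    | succ n ih =>
      intro a ha x hx
      rw [Function.iterate_succ_apply, Function.iterate_succ_apply, hhom a ha x hx,
        ih a ha _ (hBK x hx)]
  have hitmono : ∀ n : ℕ, ∀ x ∈ K, ∀ y ∈ K, y - x ∈ K → B^[n] y - B^[n] x ∈ K := by
    intro n
    induction n with
    | zero => intro x hx y hy h; simpa using h
    | succ n ih =>
      intro x hx y hy h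
      rw [Function.iterate_succ_apply, Function.iterate_succ_apply]
      exact ih _ (hBK x hx) _ (hBK y hy) (hmono x hx y hy h)
  obtain ⟨M0, hM0⟩ := hbdd
  obtain ⟨C0, hC0⟩ := hnormalpt
  set M := max M0 0 with hM
  have hMnn : 0 ≤ M := le_max_right _ _
  set C := max C0 1 with hC
  have hC1 : 1 ≤ C := le_max_right _ _
  have hBn : ∀ x ∈ K, ‖B x‖ ≤ M * ‖x‖ := by
    intro x hx
    by_cases h0 : x = 0
    · have h := hhom 0 le_rfl x hx
      rw [zero_smul, zero_smul] at h
      rw [h0, h]; simp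
    · have hp : 0 < ‖x‖ := norm_pos_iff.mpr h0
      have hxn : ‖x‖⁻¹ • x ∈ K := hsmul _ (by positivity) x hx
      have h1 : ‖B (‖x‖⁻¹ • x)‖ ≤ M0 := by
        apply hM0
        refine ⟨_, hxn, ?_, rfl⟩
        rw [norm_smul, norm_inv, norm_norm, inv_mul_cancel₀ hp.ne']
      rw [hhom _ (by positivity) x hx, norm_smul, norm_inv, norm_norm] at h1
      have h2 : ‖x‖⁻¹ * ‖B x‖ ≤ M := h1.trans (le_max_left _ _)
      rwa [inv_mul_le_iff₀ hp, mul_comm] at h2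
  have hitn : ∀ n : ℕ, ∀ x ∈ K, ‖B^[n] x‖ ≤ M ^ n * ‖x‖ := by
    intro n
    induction n with
    | zero => intro x hx; simp
    | succ n ih =>
      intro x hx
      rw [Function.iterate_succ_apply, pow_succ, mul_assoc]
      exact (ih _ (hBK x hx)).trans (mul_le_mul_of_nonneg_left (hBn x hx) (by positivity))
  refine le_of_forall_gt_imp_ge_of_dense ?_
  intro β hβ
  have hβ0 : 0 < β := lt_of_le_of_lt hα hβ
  have hβk : β ^ k • u - B^[k] u ∈ K := by
    have h1 : (β ^ k - α ^ k) • u ∈ K :=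
      hsmul _ (sub_nonneg.mpr (pow_le_pow_left₀ hα hβ.le k)) u hu
    have h2 := hadd _ h1 _ hBk
    rw [sub_smul] at h2
    simpa using h2
  have hm : ∀ m : ℕ, β ^ (k * m) • u - B^[k * m] u ∈ K := by
    intro m
    induction m with
    | zero =>
      simpa using hsmul 0 le_rfl u hu
    | succ m ih =>
      have h1 := hitmono k _ (hitK _ u hu) _ (hsmul (β ^ (k * m)) (by positivity) u hu) ih
      rw [hithom k _ (by positivity) u hu, ← Function.iterate_add_apply] at h1
      have h2 := hsmul (β ^ (k * m)) (by positivity) _ hβk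
      have h3 := hadd _ h2 _ h1
      rw [smul_sub, smul_smul, ← pow_add] at h3
      rw [show k * (m + 1) = k + k * m by ring]
      rw [show k * m + k = k + k * m by ring] at h3
      simpa using h3
  have hmn : ∀ m : ℕ, ‖B^[k * m] u‖ ≤ C * β ^ (k * m) := by
    intro m
    have hp : 0 < β ^ (k * m) := by positivity
    have h1 : ‖(β ^ (k * m))⁻¹ • B^[k * m] u‖ ≤ C0 := by
      apply hC0
      refine ⟨_, hsmul _ (by positivity) _ (hitK _ u hu), ?_, rfl⟩
      have h2 := hsmul (β ^ (k * m))⁻¹ (by positivity) _ (hm m)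
      rwa [smul_sub, smul_smul, inv_mul_cancel₀ hp.ne', one_smul] at h2
    rw [norm_smul, norm_inv, Real.norm_of_nonneg hp.le] at h1
    have h2 : (β ^ (k * m))⁻¹ * ‖B^[k * m] u‖ ≤ C := h1.trans (le_max_left _ _)
    rw [inv_mul_le_iff₀ hp] at h2
    linarith
  set Q := max 1 (M / β) with hQ
  have hQ1 : 1 ≤ Q := le_max_left _ _
  set D := C * Q ^ k with hD
  have hDpos : 0 < D := by positivity
  have hall : ∀ n : ℕ, ‖B^[n] u‖ ≤ D * β ^ n := by
    intro n
    have hn : n = n % k + k * (n / k) := (Nat.mod_add_div n k).symm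
    have hr : n % k ≤ k := (Nat.mod_lt n hk).le
    generalize n % k = r at hn hr
    generalize n / k = m at hn
    subst hn
    rw [Function.iterate_add_apply]
    have hMQ : M ≤ Q * β := by
      rw [← div_le_iff₀ hβ0]; exact le_max_right _ _
    calc ‖B^[r] (B^[k * m] u)‖ ≤ M ^ r * ‖B^[k * m] u‖ := hitn r _ (hitK _ u hu)
      _ ≤ (Q * β) ^ r * (C * β ^ (k * m)) := by
        gcongr
        exact hmn m
      _ = C * Q ^ r * β ^ (r + k * m) := by rw [mul_pow, pow_add]; ring
      _ ≤ D * β ^ (r + k * m) := by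
        rw [hD]
        gcongr
  have hlim : Tendsto (fun n : ℕ => D ^ ((n : ℝ)⁻¹) * β) atTop (𝓝 β) := by
    have h1 : Tendsto (fun n : ℕ => D ^ ((n : ℝ)⁻¹)) atTop (𝓝 (D ^ (0 : ℝ))) :=
      Tendsto.comp (Real.continuousAt_const_rpow hDpos.ne')
        (tendsto_inv_atTop_nhds_zero_nat (𝕜 := ℝ))
    rw [Real.rpow_zero] at h1
    simpa using h1.mul_const β
  rw [← hlim.limsup_eq]
  refine limsup_le_limsup ?_ ?_ hlim.isBoundedUnder_le
  · filter_upwards [eventually_gt_atTop 0] with n hn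
    calc ‖B^[n] u‖ ^ ((n : ℝ)⁻¹) ≤ (D * β ^ n) ^ ((n : ℝ)⁻¹) :=
          Real.rpow_le_rpow (norm_nonneg _) (hall n) (by positivity)
      _ = D ^ ((n : ℝ)⁻¹) * β := by
        rw [Real.mul_rpow hDpos.le (by positivity), Real.pow_rpow_inv_natCast hβ0.le hn.ne']
  · exact IsBoundedUnder.isCoboundedUnder_le
      (isBoundedUnder_of ⟨0, fun n => Real.rpow_nonneg (norm_nonneg _) _⟩)
end
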